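/- Every co-k-threshold hypergraph is Laplacian r-integral for some r ∈ ℚ. -/

import Mathlib

open Finset

/-- The hypergraph Laplacian as an operator on real-valued vertex functions:
`(L_G f)(v) = ∑_{e ∋ v} (1/(|e|-1)) ∑_{u ∈ e} (f v - f u)`. -/
noncomputable def lapOp {V : Type} [Fintype V] [DecidableEq V] (E : Finset (Finset V)) (f : V → ℝ) : V → ℝ :=
  fun v => ∑ e ∈ E.filter (fun e => v ∈ e), (1 / ((e.card : ℝ) - 1)) * ∑ u ∈ e, (f v - f u)

/-- The matrix of the hypergraph Laplacian. -/
noncomputable def lapMatrix {V : Type} [Fintype V] [DecidableEq V] (E : Finset (Finset V)) : Matrix V V ℝ :=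
  Matrix.of fun v w => ∑ e ∈ E.filter (fun e => v ∈ e),
    (1 / ((e.card : ℝ) - 1)) * ((if w = v then (e.card : ℝ) else 0) - (if w ∈ e then 1 else 0))

/-- Edge set obtained from `E` by adding a `k`-dominating set `S = Fin k` of fresh vertices:
the new edges are `S ∪ {u}` for every old vertex `u`. -/
def domEdges {V : Type} [Fintype V] [DecidableEq V] (E : Finset (Finset V)) (k : ℕ) :
    Finset (Finset (V ⊕ Fin k)) :=
  E.image (Finset.image Sum.inl) ∪
    (Finset.univ : Finset V).image
      (fun u => insert (Sum.inl u) ((Finset.univ : Finset (Fin k)).image Sum.inr))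

/-- Vertex type of the threshold hypergraph with string `0^{m 0} (k 0) 0^{m 1} (k 1) ⋯`:
`inl ⟨i, a⟩` is the `a`-th isolated vertex added before the `i`-th domination, and
`inr ⟨i, b⟩` is the `b`-th vertex of the `i`-th dominating set. -/
abbrev TV (d : ℕ) (m k : Fin d → ℕ) : Type :=
  (Σ i : Fin d, Fin (m i)) ⊕ (Σ i : Fin d, Fin (k i))

/-- Vertices present just before the `i`-th domination is applied. -/
def before (d : ℕ) (m k : Fin d → ℕ) (i : Fin d) : Finset (TV d m k) :=
  (((Finset.univ.filter (fun j : Fin d => j ≤ i)).sigma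
      fun j => (Finset.univ : Finset (Fin (m j)))).image Sum.inl) ∪
  (((Finset.univ.filter (fun j : Fin d => j < i)).sigma
      fun j => (Finset.univ : Finset (Fin (k j)))).image Sum.inr)

/-- The `i`-th dominating set. -/
def domSet (d : ℕ) (m k : Fin d → ℕ) (i : Fin d) : Finset (TV d m k) :=
  (Finset.univ : Finset (Fin (k i))).image fun b => Sum.inr ⟨i, b⟩

/-- The edge set of the threshold hypergraph `0^{m 0} (k 0) 0^{m 1} (k 1) ⋯ 0^{m (d-1)} (k (d-1))`:
the `i`-th domination adds the edges `S_i ∪ {u}` for all previously present vertices `u`. -/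
def thrEdges (d : ℕ) (m k : Fin d → ℕ) : Finset (Finset (TV d m k)) :=
  Finset.univ.biUnion fun i : Fin d =>
    (before d m k i).image fun u => insert u (domSet d m k i)

/-- A hypergraph with vertex set `Fin n`. -/
structure HG where
  n : ℕ
  E : Finset (Finset (Fin n))

/-- The class of co-`k`-threshold hypergraphs: `k`-threshold hypergraphs (up to relabelling
of vertices), closed under `(k+1)`-uniform complement and disjoint union. -/
inductive CoK (k : ℕ) : HG → Prop where
  | thr (d : ℕ) (m : Fin d → ℕ) (hm : ∀ h : 0 < d, 1 ≤ m ⟨0, h⟩) (n : ℕ)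
      (g : TV d m (fun _ => k) ≃ Fin n) :
      CoK k ⟨n, (thrEdges d m fun _ => k).image (Finset.image fun v => g v)⟩
  | compl (G : HG) : CoK k G → CoK k ⟨G.n, (Finset.univ.powersetCard (k + 1)) \ G.E⟩
  | union (G₁ G₂ : HG) : CoK k G₁ → CoK k G₂ →
      CoK k ⟨G₁.n + G₂.n,
        G₁.E.image (Finset.image (Fin.castAdd G₂.n)) ∪
          G₂.E.image (Finset.image (Fin.natAdd G₁.n))⟩

section Laplacian

variable {V W : Type} [Fintype V] [DecidableEq V] [Fintype W] [DecidableEq W]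

/-- All eigenvalues of the hypergraph Laplacian are rational. -/
def HasRationalSpectrum (E : Finset (Finset V)) : Prop :=
  ∀ (lam : ℝ) (f : V → ℝ), f ≠ 0 → lapOp E f = lam • f → ∃ q : ℚ, lam = q

/-- The hypergraph Laplacian as a linear endomorphism. -/
noncomputable def lapEnd (E : Finset (Finset V)) : Module.End ℝ (V → ℝ) where
  toFun := lapOp E
  map_add' f g := by
    ext v
    simp only [lapOp, Pi.add_apply, ← sum_add_distrib, ← mul_add]
    refine sum_congr rfl fun e _ => congrArg _ (sum_congr rfl fun u _ => by ring)
  map_smul' c f := by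
    ext v
    simp only [lapOp, Pi.smul_apply, smul_eq_mul, mul_sum, RingHom.id_apply]
    refine sum_congr rfl fun e _ => sum_congr rfl fun u _ => by ring

theorem HasRationalSpectrum.exists_common_divisor {E : Finset (Finset V)}
    (h : HasRationalSpectrum E) :
    ∃ r : ℚ, ∀ (lam : ℝ) (f : V → ℝ), f ≠ 0 → lapOp E f = lam • f →
      ∃ p : ℤ, lam = (r : ℝ) * p := by
  have hfin : Set.Finite {μ : ℝ | (lapEnd E).HasEigenvalue μ} :=
    Module.End.finite_hasEigenvalue (lapEnd E)
  have hfinq : Set.Finite {q : ℚ | (lapEnd E).HasEigenvalue (q : ℝ)} :=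
    hfin.preimage Rat.cast_injective.injOn
  refine ⟨1 / (∏ q ∈ hfinq.toFinset, q.den : ℕ), fun lam f hf hlam => ?_⟩
  obtain ⟨q, rfl⟩ := h lam f hf hlam
  have hq : q ∈ hfinq.toFinset := by
    rw [Set.Finite.mem_toFinset]
    exact Module.End.hasEigenvalue_of_hasEigenvector
      (x := f) ⟨Module.End.mem_eigenspace_iff.2 hlam, hf⟩
  obtain ⟨c, hc⟩ := dvd_prod_of_mem (fun q : ℚ => q.den) hq
  have hpos : (∏ q ∈ hfinq.toFinset, q.den : ℕ) ≠ 0 :=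
    prod_ne_zero_iff.2 fun q _ => q.den_nz
  refine ⟨q.num * c, ?_⟩
  rw [hc] at hpos ⊢
  have hqd : (q : ℝ) = q.num / q.den := by exact_mod_cast (Rat.num_div_den q).symm
  have hc0 : (c : ℝ) ≠ 0 := by
    rintro h0
    exact hpos (by simp [Nat.cast_eq_zero.1 h0])
  have hd0 : (q.den : ℝ) ≠ 0 := by exact_mod_cast q.den_nz
  push_cast
  rw [hqd]
  field_simp

theorem lapOp_union_of_disjoint {E F : Finset (Finset V)} (h : Disjoint E F) (f : V → ℝ) (v : V) :
    lapOp (E ∪ F) f v = lapOp E f v + lapOp F f v := by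
  simp only [lapOp, filter_union]
  exact sum_union (disjoint_filter_filter h)

theorem lapOp_eq_zero_of_forall_notMem {E : Finset (Finset V)} {v : V} (h : ∀ e ∈ E, v ∉ e)
    (f : V → ℝ) : lapOp E f v = 0 := by
  rw [lapOp, filter_false_of_mem h, sum_empty]

theorem lapOp_union_eq_left {E F : Finset (Finset V)} {v : V} (h : ∀ e ∈ F, v ∉ e)
    (f : V → ℝ) : lapOp (E ∪ F) f v = lapOp E f v := by
  rw [lapOp, filter_union, filter_false_of_mem h, union_empty, lapOp]

theorem lapOp_image {φ : V → W} (hφ : Function.Injective φ) (E : Finset (Finset V))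
    (f : W → ℝ) (v : V) :
    lapOp (E.image (Finset.image φ)) f (φ v) = lapOp E (f ∘ φ) v := by
  have hfil : (E.image (Finset.image φ)).filter (fun e => φ v ∈ e)
      = (E.filter (fun e => v ∈ e)).image (Finset.image φ) := by
    rw [filter_image]
    simp only [hφ.mem_finset_image]
  rw [lapOp, hfil, sum_image (image_injective hφ).injOn, lapOp]
  refine sum_congr rfl fun e _ => ?_
  rw [card_image_of_injective _ hφ, sum_image hφ.injOn]
  rfl

theorem sum_lapOp (E : Finset (Finset V)) (f : V → ℝ) : ∑ v, lapOp E f v = 0 := by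
  simp only [lapOp, sum_filter]
  rw [sum_comm]
  refine sum_eq_zero fun e _ => ?_
  rw [← sum_filter, filter_mem_eq_inter, univ_inter, ← mul_sum]
  simp only [sum_sub_distrib]
  rw [sum_comm, sub_self, mul_zero]

theorem sum_eq_zero_of_lapOp_eq_smul {E : Finset (Finset V)} {lam : ℝ} {f : V → ℝ}
    (hlam : lam ≠ 0) (h : lapOp E f = lam • f) : ∑ v, f v = 0 := by
  have := sum_lapOp E f
  simp only [h, Pi.smul_apply, smul_eq_mul, ← mul_sum] at this
  exact (mul_eq_zero.1 this).resolve_left hlam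

theorem hasRationalSpectrum_empty : HasRationalSpectrum (∅ : Finset (Finset V)) := by
  intro lam f hf h
  obtain ⟨v, hv⟩ := Function.ne_iff.1 hf
  have := congrFun h v
  rw [lapOp_eq_zero_of_forall_notMem (by simp)] at this
  exact ⟨0, by simpa using (mul_eq_zero.1 this.symm).resolve_right hv⟩

theorem HasRationalSpectrum.image_equiv {E : Finset (Finset V)} (h : HasRationalSpectrum E)
    (g : V ≃ W) : HasRationalSpectrum (E.image (Finset.image g)) := by
  intro lam f hf hlam
  refine h lam (f ∘ g) (fun h0 => hf ?_) (funext fun v => ?_)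
  · ext w
    simpa using congrFun h0 (g.symm w)
  · rw [← lapOp_image g.injective, hlam]
    rfl

theorem HasRationalSpectrum.union {p q : ℕ} {E : Finset (Finset (Fin p))}
    {F : Finset (Finset (Fin q))} (hE : HasRationalSpectrum E) (hF : HasRationalSpectrum F) :
    HasRationalSpectrum
      (E.image (Finset.image (Fin.castAdd q)) ∪ F.image (Finset.image (Fin.natAdd p))) := by
  intro lam f hf hlam
  have hl : lapOp E (f ∘ Fin.castAdd q) = lam • (f ∘ Fin.castAdd q) := by
    ext v
    rw [← lapOp_image (Fin.castAdd_injective p q), ← lapOp_union_eq_left, hlam]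
    · rfl
    · simp only [mem_image]
      rintro _ ⟨e, -, rfl⟩ hv
      obtain ⟨u, -, hu⟩ := mem_image.1 hv
      exact absurd (congrArg Fin.val hu) (by simp; omega)
  have hr : lapOp F (f ∘ Fin.natAdd p) = lam • (f ∘ Fin.natAdd p) := by
    ext v
    rw [union_comm] at hlam
    rw [← lapOp_image (Fin.natAdd_injective q p), ← lapOp_union_eq_left, hlam]
    · rfl
    · simp only [mem_image]
      rintro _ ⟨e, -, rfl⟩ hv
      obtain ⟨u, -, hu⟩ := mem_image.1 hv
      exact absurd (congrArg Fin.val hu) (by simp; omega)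
  by_cases h0 : f ∘ Fin.castAdd q = 0
  · refine hF lam _ (fun h1 => hf (funext fun v => ?_)) hr
    induction v using Fin.addCases with
    | left v => exact congrFun h0 v
    | right v => exact congrFun h1 v
  · exact hE lam _ h0 hl

theorem card_powersetCard_filter_mem_mem {k : ℕ} (hk : 0 < k) {u v : V} (huv : u ≠ v) :
    #{e ∈ (univ : Finset V).powersetCard (k + 1) | v ∈ e ∧ u ∈ e}
      = (Fintype.card V - 2).choose (k - 1) := by
  have hs : #((univ : Finset V) \ {u, v}) = Fintype.card V - 2 := by
    rw [card_sdiff_of_subset (subset_univ _), card_pair huv, card_univ]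
  rw [← hs, ← card_powersetCard]
  refine card_bij' (fun e _ => e \ {u, v}) (fun e _ => e ∪ {u, v}) ?_ ?_ ?_ ?_
  · intro e he
    simp only [mem_filter, mem_powersetCard] at he ⊢
    refine ⟨sdiff_subset_sdiff (subset_univ _) subset_rfl, ?_⟩
    rw [card_sdiff_of_subset (by grind), card_pair huv, he.1.2]
    omega
  · intro e he
    simp only [mem_filter, mem_powersetCard] at he ⊢
    refine ⟨⟨subset_univ _, ?_⟩, by simp, by simp⟩
    rw [card_union_of_disjoint (disjoint_of_subset_left he.1 sdiff_disjoint), card_pair huv, he.2]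
    omega
  · intro e he
    grind
  · intro e he
    have := (mem_powersetCard.1 he).1
    ext x
    have := @this x
    grind

theorem lapOp_powersetCard {k : ℕ} (hk : 0 < k) (f : V → ℝ) (v : V) :
    lapOp ((univ : Finset V).powersetCard (k + 1)) f v
      = (1 / (k : ℝ)) * ((Fintype.card V - 2).choose (k - 1) : ℝ)
        * (Fintype.card V * f v - ∑ u, f u) := by
  have hstep : lapOp ((univ : Finset V).powersetCard (k + 1)) f v
      = (1 / (k : ℝ)) * ∑ e ∈ (univ : Finset V).powersetCard (k + 1) with v ∈ e,
          ∑ u, if u ∈ e then f v - f u else 0 := by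
    rw [lapOp, mul_sum]
    refine sum_congr rfl fun e he => ?_
    rw [(mem_powersetCard.1 (mem_filter.1 he).1).2, ← sum_filter, filter_mem_eq_inter, univ_inter]
    simp
  rw [hstep, sum_comm, mul_assoc]
  congr 1
  have hterm : ∀ u, (∑ e ∈ (univ : Finset V).powersetCard (k + 1) with v ∈ e,
      if u ∈ e then f v - f u else 0)
        = ((Fintype.card V - 2).choose (k - 1) : ℝ) * (f v - f u) := by
    intro u
    by_cases huv : u = v
    · simp [huv]
    · rw [← sum_filter, filter_filter, sum_const, card_powersetCard_filter_mem_mem hk huv,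
        nsmul_eq_mul]
  simp only [hterm, ← mul_sum, sum_sub_distrib, sum_const, card_univ, nsmul_eq_mul]

theorem HasRationalSpectrum.compl {k : ℕ} (hk : 0 < k) {E : Finset (Finset V)}
    (hE : E ⊆ univ.powersetCard (k + 1)) (h : HasRationalSpectrum E) :
    HasRationalSpectrum (univ.powersetCard (k + 1) \ E) := by
  intro lam f hf hlam
  by_cases h0 : lam = 0
  · exact ⟨0, by simp [h0]⟩
  have hsum := sum_eq_zero_of_lapOp_eq_smul h0 hlam
  have hcomp (v : V) := lapOp_union_of_disjoint
    (disjoint_sdiff : Disjoint E (univ.powersetCard (k + 1) \ E)) f v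
  simp only [union_sdiff_of_subset hE, lapOp_powersetCard hk, hsum, hlam, Pi.smul_apply,
    smul_eq_mul] at hcomp
  obtain ⟨q, hq⟩ := h ((1 / (k : ℝ)) * ((Fintype.card V - 2).choose (k - 1) : ℝ)
    * Fintype.card V - lam) f hf (funext fun v => by
      simp only [Pi.smul_apply, smul_eq_mul]
      linear_combination -hcomp v)
  refine ⟨(1 / (k : ℚ)) * ((Fintype.card V - 2).choose (k - 1) : ℚ) * Fintype.card V - q, ?_⟩
  push_cast
  linear_combination -hq

/-- The edges `S ∪ {u}` added when the set `S` dominates the vertices in `B`. -/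
def dominationEdges (B S : Finset V) : Finset (Finset V) :=
  B.image fun u => insert u S

theorem lapOp_dominationEdges_of_mem_left {B S : Finset V} (h : Disjoint B S) (f : V → ℝ) {v : V}
    (hv : v ∈ B) :
    lapOp (dominationEdges B S) f v = (1 / (#S : ℝ)) * ∑ w ∈ S, (f v - f w) := by
  have hvS : v ∉ S := disjoint_left.1 h hv
  have hfil : (dominationEdges B S).filter (fun e => v ∈ e) = {insert v S} := by
    ext e
    simp only [dominationEdges, mem_filter, mem_image, mem_singleton]
    grind
  rw [lapOp, hfil, sum_singleton, card_insert_of_notMem hvS, sum_insert hvS]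
  simp

theorem lapOp_dominationEdges_of_mem_right {B S : Finset V} (h : Disjoint B S) (f : V → ℝ) {v : V}
    (hv : v ∈ S) :
    lapOp (dominationEdges B S) f v
      = (1 / (#S : ℝ)) * (#B * ((#S + 1) * f v - ∑ w ∈ S, f w) - ∑ u ∈ B, f u) := by
  have hfil : (dominationEdges B S).filter (fun e => v ∈ e) = dominationEdges B S :=
    filter_true_of_mem fun e he => by
      obtain ⟨u, -, rfl⟩ := mem_image.1 he
      exact mem_insert_of_mem hv
  have hinj : Set.InjOn (fun u => insert u S) (B : Set V) := by
    intro a ha b hb hab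
    have haS : a ∉ S := disjoint_left.1 h ha
    have : a ∈ insert b S := (show insert a S = insert b S from hab) ▸ mem_insert_self a S
    exact (mem_insert.1 this).resolve_right haS
  rw [lapOp, hfil, dominationEdges, sum_image hinj]
  have hterm : ∀ u ∈ B, (1 / ((#(insert u S) : ℝ) - 1)) * ∑ w ∈ insert u S, (f v - f w)
      = (1 / (#S : ℝ)) * (((#S + 1) * f v - ∑ w ∈ S, f w) - f u) := by
    intro u hu
    have huS : u ∉ S := disjoint_left.1 h hu
    rw [card_insert_of_notMem huS, sum_insert huS]
    simp only [sum_sub_distrib, sum_const, nsmul_eq_mul]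
    push_cast
    ring
  rw [sum_congr rfl hterm, ← mul_sum, sum_sub_distrib, sum_const, nsmul_eq_mul]

theorem HasRationalSpectrum.union_dominationEdges {E : Finset (Finset V)} {B S : Finset V}
    (hE : ∀ e ∈ E, e ⊆ B) (h : Disjoint B S) (hS : S.Nonempty) (hrat : HasRationalSpectrum E) :
    HasRationalSpectrum (E ∪ dominationEdges B S) := by
  intro lam f hf hlam
  by_cases h0 : lam = 0
  · exact ⟨0, by simp [h0]⟩
  have hsum := sum_eq_zero_of_lapOp_eq_smul h0 hlam
  have hS0 : (#S : ℝ) ≠ 0 := by exact_mod_cast hS.card_ne_zero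
  have hEB : ∀ v ∉ B, ∀ e ∈ E, v ∉ e := fun v hv e he hve => hv (hE e he hve)
  have hdisj : Disjoint E (dominationEdges B S) := by
    rw [disjoint_left]
    intro e he hed
    obtain ⟨s, hs⟩ := hS
    obtain ⟨u, -, rfl⟩ := mem_image.1 hed
    exact disjoint_left.1 h (hE _ he (mem_insert_of_mem hs)) hs
  have hev (v : V) : lam * f v = lapOp E f v + lapOp (dominationEdges B S) f v := by
    rw [← lapOp_union_of_disjoint hdisj, hlam]
    rfl
  have hout : ∀ v, v ∉ B → v ∉ S → f v = 0 := by
    intro v hB hvS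
    have := hev v
    rw [lapOp_eq_zero_of_forall_notMem (hEB v hB), lapOp_eq_zero_of_forall_notMem] at this
    · simpa [h0] using this
    · intro e he
      obtain ⟨u, hu, rfl⟩ := mem_image.1 he
      grind
  have hBS : ∑ u ∈ B, f u + ∑ w ∈ S, f w = 0 := by
    rw [← sum_union h, ← hsum]
    exact sum_subset (subset_univ _) fun v _ hv => by
      rw [mem_union, not_or] at hv
      exact hout v hv.1 hv.2
  have hevS : ∀ v ∈ S, lam * f v
      = (1 / (#S : ℝ)) * (#B * ((#S + 1) * f v - ∑ w ∈ S, f w) - ∑ u ∈ B, f u) := by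
    intro v hv
    rw [hev v, lapOp_eq_zero_of_forall_notMem (hEB v (disjoint_right.1 h hv)), zero_add,
      lapOp_dominationEdges_of_mem_right h f hv]
  by_cases h1 : lam = (1 / (#S : ℝ)) * #B * (#S + 1)
  · exact ⟨(1 / (#S : ℚ)) * #B * (#S + 1), by rw [h1]; push_cast; rfl⟩
  obtain ⟨s, hs⟩ := hS
  have hconst : ∀ v ∈ S, f v = f s := by
    intro v hv
    have : (lam - (1 / (#S : ℝ)) * #B * (#S + 1)) * (f v - f s) = 0 := by
      linear_combination hevS v hv - hevS s hs
    exact sub_eq_zero.1 ((mul_eq_zero.1 this).resolve_left (sub_ne_zero.2 h1))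
  have hsumS : ∑ w ∈ S, f w = #S * f s := by
    rw [sum_congr rfl hconst, sum_const, nsmul_eq_mul]
  by_cases h2 : f s = 0
  · have hf0 : ∀ v ∉ B, f v = 0 := fun v hv => by
      by_cases hvS : v ∈ S
      · rw [hconst v hvS, h2]
      · exact hout v hv hvS
    obtain ⟨q, hq⟩ := hrat (lam - 1) f hf (funext fun v => by
      simp only [Pi.smul_apply, smul_eq_mul]
      by_cases hv : v ∈ B
      · have := hev v
        rw [lapOp_dominationEdges_of_mem_left h f hv, sum_sub_distrib, hsumS, h2, sum_const,
          nsmul_eq_mul] at this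
        field_simp at this
        linear_combination -this
      · rw [lapOp_eq_zero_of_forall_notMem (hEB v hv), hf0 v hv, mul_zero])
    exact ⟨q + 1, by push_cast; linear_combination hq⟩
  · refine ⟨(1 / (#S : ℚ)) * (#B + #S), ?_⟩
    have := hevS s hs
    rw [eq_neg_of_add_eq_zero_left hBS, hsumS] at this
    refine mul_right_cancel₀ h2 ?_
    push_cast
    rw [this]
    ring

end Laplacian

section Threshold

variable {d : ℕ} {m k : Fin d → ℕ}

theorem disjoint_before_domSet (i : Fin d) : Disjoint (before d m k i) (domSet d m k i) := by
  rw [disjoint_left]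
  intro v hv hv'
  simp only [domSet, mem_image, mem_univ, true_and] at hv'
  obtain ⟨b, rfl⟩ := hv'
  simp [before] at hv

theorem card_domSet (i : Fin d) : #(domSet d m k i) = k i := by
  rw [domSet, card_image_of_injective, card_univ, Fintype.card_fin]
  intro a b hab
  simpa using hab

theorem before_subset_before {i j : Fin d} (hij : i ≤ j) :
    before d m k i ⊆ before d m k j := by
  rintro (⟨a, b⟩ | ⟨a, b⟩) hv
  · simp [before] at hv ⊢
    exact hv.trans hij
  · simp [before] at hv ⊢
    exact hv.trans_le hij

theorem domSet_subset_before {i j : Fin d} (hij : i < j) :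
    domSet d m k i ⊆ before d m k j := by
  intro v hv
  simp only [domSet, mem_image, mem_univ, true_and] at hv
  obtain ⟨b, rfl⟩ := hv
  simpa [before] using hij

theorem thrEdges_eq_biUnion :
    thrEdges d m k
      = univ.biUnion fun i => dominationEdges (before d m k i) (domSet d m k i) := rfl

theorem hasRationalSpectrum_thrEdges (hk : ∀ i, 0 < k i) :
    HasRationalSpectrum (thrEdges d m k) := by
  have key : ∀ t ≤ d, HasRationalSpectrum ((univ.filter fun i : Fin d => i.val < t).biUnion
      fun i => dominationEdges (before d m k i) (domSet d m k i)) := by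
    intro t
    induction t with
    | zero => simpa using hasRationalSpectrum_empty
    | succ t ih =>
      intro ht
      have hins : (univ.filter fun i : Fin d => i.val < t + 1)
          = insert (⟨t, ht⟩ : Fin d) (univ.filter fun i : Fin d => i.val < t) := by
        ext i
        simp only [mem_filter, mem_univ, true_and, mem_insert, Fin.ext_iff]
        omega
      rw [hins, biUnion_insert, union_comm]
      refine (ih (by omega)).union_dominationEdges ?_ (disjoint_before_domSet _) ?_
      · intro e he
        simp only [mem_biUnion, mem_filter, mem_univ, true_and, dominationEdges, mem_image] at he
        obtain ⟨i, hi, u, hu, rfl⟩ := he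
        have hlt : i < ⟨t, ht⟩ := hi
        exact insert_subset (before_subset_before hlt.le hu) (domSet_subset_before hlt)
      · rw [← card_pos, card_domSet]
        exact hk _
  simpa [thrEdges_eq_biUnion] using key d le_rfl

theorem card_of_mem_thrEdges {k : ℕ} {e : Finset (TV d m fun _ => k)}
    (he : e ∈ thrEdges d m fun _ => k) : #e = k + 1 := by
  simp only [thrEdges, mem_biUnion, mem_univ, true_and, mem_image] at he
  obtain ⟨i, u, hu, rfl⟩ := he
  rw [card_insert_of_notMem (disjoint_left.1 (disjoint_before_domSet i) hu), card_domSet]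

end Threshold

theorem CoK.subset_powersetCard {k : ℕ} {G : HG} (h : CoK k G) :
    G.E ⊆ univ.powersetCard (k + 1) := by
  induction h with
  | thr d m hm n g =>
    intro e he
    obtain ⟨e₀, he₀, rfl⟩ := mem_image.1 he
    rw [mem_powersetCard, card_image_of_injective _ g.injective]
    exact ⟨subset_univ _, card_of_mem_thrEdges he₀⟩
  | compl G _ _ => exact sdiff_subset
  | union G₁ G₂ _ _ ih₁ ih₂ =>
    intro e he
    rw [mem_powersetCard]
    refine ⟨subset_univ _, ?_⟩
    rcases mem_union.1 he with he | he <;> obtain ⟨e₀, he₀, rfl⟩ := mem_image.1 he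
    · rw [card_image_of_injective _ (Fin.castAdd_injective _ _)]
      exact (mem_powersetCard.1 (ih₁ he₀)).2
    · rw [card_image_of_injective _ (Fin.natAdd_injective _ _)]
      exact (mem_powersetCard.1 (ih₂ he₀)).2

theorem CoK.hasRationalSpectrum {k : ℕ} (hk : 0 < k) {G : HG} (h : CoK k G) :
    HasRationalSpectrum G.E := by
  induction h with
  | thr d m hm n g => exact (hasRationalSpectrum_thrEdges fun _ => hk).image_equiv g
  | compl G hG ih => exact ih.compl hk hG.subset_powersetCard
  | union G₁ G₂ _ _ ih₁ ih₂ => exact ih₁.union ih₂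

/-- Every co-`k`-threshold hypergraph is Laplacian `r`-integral for some rational `r`. -/
theorem stmt_16 (k : ℕ) (hk : 0 < k) (G : HG) (h : CoK k G) :
    ∃ r : ℚ, ∀ (lam : ℝ) (f : Fin G.n → ℝ), f ≠ 0 →
      lapOp G.E f = lam • f → ∃ p : ℤ, lam = (r : ℝ) * p :=
  (h.hasRationalSpectrum hk).exists_common_divisor
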